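/- Let n ≥ 1, let 0 < τ₁ < τ₂ be temperatures with τ_δ = 1/τ₁ − 1/τ₂, let L ∈ ℝ^{n×n} be a symmetric matrix, let c ≥ 0, and let U : ℝⁿ → ℝ be continuously differentiable. Then for all twice continuously differentiable compactly supported f, g : ℝⁿ × ℝⁿ → ℝ, the detailed-balance identity holds: ∫∫ g(x,y) (𝓛ᶜf)(x,y) π(x,y) dx dy = ∫∫ f(x,y) (𝓛ᶜg)(x,y) π(x,y) dx dy, where the integrals are Lebesgue integrals over ℝⁿ × ℝⁿ. -/

import Mathlib

open MeasureTheory Matrix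

/-- The swap function `s(x,y) = min{1, exp(τ_δ (U(x) − U(y)))}` with `τ_δ = 1/τ₁ − 1/τ₂`. -/
noncomputable def swapS {n : ℕ} (τ₁ τ₂ : ℝ) (U : (Fin n → ℝ) → ℝ) (x y : Fin n → ℝ) : ℝ :=
  min 1 (Real.exp ((1 / τ₁ - 1 / τ₂) * (U x - U y)))

/-- The joint density `π(x,y) = exp(−U(x)/τ₁ − U(y)/τ₂)`. -/
noncomputable def jointDensity {n : ℕ} (τ₁ τ₂ : ℝ) (U : (Fin n → ℝ) → ℝ)
    (x y : Fin n → ℝ) : ℝ :=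
  Real.exp (-(U x) / τ₁ - U y / τ₂)

/-- The gradient vector of `h : ℝⁿ → ℝ` at `x`, with components `∂h/∂x_i(x)`. -/
noncomputable def gradVec {n : ℕ} (h : (Fin n → ℝ) → ℝ) (x : Fin n → ℝ) : Fin n → ℝ :=
  fun i => fderiv ℝ h x (Pi.single i 1)

/-- The generator `𝓛ᶜ` of the replica exchange preconditioned Langevin jump process:
`(𝓛ᶜf)(x,y) = −(L∇ₓU(x))·∇ₓf + τ₁ Σ L_{ij} ∂²f/∂x_i∂x_j − (L∇_yU(y))·∇_yf
 + τ₂ Σ L_{ij} ∂²f/∂y_i∂y_j + c s(x,y)(f(y,x) − f(x,y))`. -/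
noncomputable def repGen {n : ℕ} (L : Matrix (Fin n) (Fin n) ℝ) (τ₁ τ₂ c : ℝ)
    (U : (Fin n → ℝ) → ℝ) (f : (Fin n → ℝ) → (Fin n → ℝ) → ℝ) (x y : Fin n → ℝ) : ℝ :=
  -((L.mulVec (gradVec U x)) ⬝ᵥ (gradVec (fun x' => f x' y) x))
    + τ₁ * ∑ i, ∑ j, L i j *
        gradVec (fun x' => gradVec (fun x'' => f x'' y) x' j) x i
    - (L.mulVec (gradVec U y)) ⬝ᵥ (gradVec (f x) y)
    + τ₂ * ∑ i, ∑ j, L i j *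
        gradVec (fun y' => gradVec (f x) y' j) y i
    + c * swapS τ₁ τ₂ U x y * (f y x - f x y)

/-- The second-order operator `∑ a i j ∂_{v i} (W ∂_{v j} F)` in divergence form. -/
noncomputable def divForm {Z ι : Type*} [NormedAddCommGroup Z] [NormedSpace ℝ Z] [Fintype ι]
    (a : Matrix ι ι ℝ) (v : ι → Z) (W F : Z → ℝ) (p : Z) : ℝ :=
  ∑ i, ∑ j, a i j * fderiv ℝ (fun q => fderiv ℝ F q (v j) * W q) p (v i)

section DivForm

variable {Z ι : Type*} [NormedAddCommGroup Z] [NormedSpace ℝ Z] [Fintype ι]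

lemma contDiff_fderiv_mul {W F : Z → ℝ} (hW : ContDiff ℝ 1 W) (hF : ContDiff ℝ 2 F) (w : Z) :
    ContDiff ℝ 1 (fun q => fderiv ℝ F q w * W q) :=
  ((hF.fderiv_right (m := 1) (by norm_num)).clm_apply contDiff_const).mul hW

lemma continuous_divForm {W F : Z → ℝ} (hW : ContDiff ℝ 1 W) (hF : ContDiff ℝ 2 F)
    (a : Matrix ι ι ℝ) (v : ι → Z) : Continuous (divForm a v W F) := by
  refine continuous_finsetSum _ fun i _ => continuous_finsetSum _ fun j _ => ?_
  exact continuous_const.mul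
    (((contDiff_fderiv_mul hW hF (v j)).continuous_fderiv (by norm_num)).clm_apply
      continuous_const)

variable [FiniteDimensional ℝ Z] [MeasurableSpace Z] [BorelSpace Z]
  (μ : Measure Z) [μ.IsAddHaarMeasure]

lemma integral_mul_fderiv_fderiv_mul {W F G : Z → ℝ} (hW : ContDiff ℝ 1 W)
    (hF : ContDiff ℝ 2 F) (hG : ContDiff ℝ 1 G) (hGc : HasCompactSupport G) (v w : Z) :
    ∫ p, G p * fderiv ℝ (fun q => fderiv ℝ F q w * W q) p v ∂μ
      = -∫ p, fderiv ℝ G p v * (fderiv ℝ F p w * W p) ∂μ := by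
  have hH := contDiff_fderiv_mul hW hF w
  have hG' : Continuous fun p => fderiv ℝ G p v :=
    (hG.continuous_fderiv (by norm_num)).clm_apply continuous_const
  have hH' : Continuous fun p => fderiv ℝ (fun q => fderiv ℝ F q w * W q) p v :=
    (hH.continuous_fderiv (by norm_num)).clm_apply continuous_const
  apply integral_mul_fderiv_eq_neg_fderiv_mul_of_integrable
  · exact (hG'.mul hH.continuous).integrable_of_hasCompactSupport
      ((hGc.fderiv_apply (𝕜 := ℝ) v).mul_right)
  · exact (hG.continuous.mul hH').integrable_of_hasCompactSupport hGc.mul_right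
  · exact (hG.continuous.mul hH.continuous).integrable_of_hasCompactSupport hGc.mul_right
  · exact fun x _ => hG.differentiable (by norm_num) x
  · exact fun x _ => hH.differentiable (by norm_num) x

lemma integral_mul_divForm {W F G : Z → ℝ} (hW : ContDiff ℝ 1 W)
    (hF : ContDiff ℝ 2 F) (hG : ContDiff ℝ 1 G) (hGc : HasCompactSupport G)
    (a : Matrix ι ι ℝ) (v : ι → Z) :
    ∫ p, G p * divForm a v W F p ∂μ
      = -∑ i, ∑ j, a i j * ∫ p, fderiv ℝ G p (v i) * (fderiv ℝ F p (v j) * W p) ∂μ := by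
  have hint (i j : ι) : Integrable
      (fun p => a i j * (G p * fderiv ℝ (fun q => fderiv ℝ F q (v j) * W q) p (v i))) μ := by
    refine Integrable.const_mul ?_ _
    exact (hG.continuous.mul
      (((contDiff_fderiv_mul hW hF (v j)).continuous_fderiv (by norm_num)).clm_apply
        continuous_const)).integrable_of_hasCompactSupport hGc.mul_right
  simp only [divForm, Finset.mul_sum, mul_left_comm (G _)]
  rw [integral_finsetSum _ fun i _ => integrable_finsetSum _ fun j _ => hint i j]
  simp_rw [integral_finsetSum _ fun j _ => hint _ j, integral_const_mul,
    integral_mul_fderiv_fderiv_mul μ hW hF hG hGc, mul_neg, Finset.sum_neg_distrib]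

/-- A symmetric operator in divergence form is symmetric with respect to integration. -/
lemma integral_mul_divForm_comm {W F G : Z → ℝ} (hW : ContDiff ℝ 1 W)
    (hF : ContDiff ℝ 2 F) (hFc : HasCompactSupport F)
    (hG : ContDiff ℝ 2 G) (hGc : HasCompactSupport G)
    {a : Matrix ι ι ℝ} (ha : a.IsSymm) (v : ι → Z) :
    ∫ p, G p * divForm a v W F p ∂μ = ∫ p, F p * divForm a v W G p ∂μ := by
  rw [integral_mul_divForm μ hW hF (hG.of_le (by norm_num)) hGc,
    integral_mul_divForm μ hW hG (hF.of_le (by norm_num)) hFc, Finset.sum_comm]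
  congr 1
  refine Finset.sum_congr rfl fun i _ => Finset.sum_congr rfl fun j _ => ?_
  rw [ha.apply]
  congr 2 with p
  ring

end DivForm

/-- An exchange operator with symmetric kernel is symmetric with respect to integration. -/
lemma integral_mul_swap_sub_comm {E : Type*} [TopologicalSpace E] [SecondCountableTopology E]
    [MeasureSpace E] [BorelSpace E] [SFinite (volume : Measure E)]
    [IsFiniteMeasureOnCompacts (volume : Measure (E × E))]
    {K F G : E × E → ℝ} (hK : Continuous K) (hKs : ∀ p, K p.swap = K p)
    (hF : Continuous F) (hFc : HasCompactSupport F)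
    (hG : Continuous G) (hGc : HasCompactSupport G) :
    ∫ p, G p * (K p * (F p.swap - F p)) = ∫ p, F p * (K p * (G p.swap - G p)) := by
  have h1 : Integrable fun p => G p * (K p * F p.swap) :=
    (hG.mul (hK.mul (hF.comp continuous_swap))).integrable_of_hasCompactSupport hGc.mul_right
  have h2 : Integrable fun p => F p * (K p * G p.swap) :=
    (hF.mul (hK.mul (hG.comp continuous_swap))).integrable_of_hasCompactSupport hFc.mul_right
  have h3 : Integrable fun p => G p * (K p * F p) :=
    (hG.mul (hK.mul hF)).integrable_of_hasCompactSupport hGc.mul_right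
  have h4 : Integrable fun p => F p * (K p * G p) :=
    (hF.mul (hK.mul hG)).integrable_of_hasCompactSupport hFc.mul_right
  simp only [mul_sub]
  rw [integral_sub h1 h3, integral_sub h2 h4]
  congr 1
  · rw [Measure.volume_eq_prod, ← integral_prod_swap]
    refine integral_congr_ae (.of_forall fun p => ?_)
    simp only [Prod.swap_swap, hKs]
    ring
  · congr 1 with p
    ring

section Partial

variable {n : ℕ}

lemma gradVec_fst {F : (Fin n → ℝ) × (Fin n → ℝ) → ℝ} (hF : Differentiable ℝ F)
    (x y : Fin n → ℝ) (i : Fin n) :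
    gradVec (fun x' => F (x', y)) x i = fderiv ℝ F (x, y) (Pi.single i 1, 0) := by
  have h := (hF (x, y)).hasFDerivAt.comp x (hasFDerivAt_prodMk_left (𝕜 := ℝ) x y)
  exact DFunLike.congr_fun h.fderiv (Pi.single i 1)

lemma gradVec_snd {F : (Fin n → ℝ) × (Fin n → ℝ) → ℝ} (hF : Differentiable ℝ F)
    (x y : Fin n → ℝ) (i : Fin n) :
    gradVec (fun y' => F (x, y')) y i = fderiv ℝ F (x, y) (0, Pi.single i 1) := by
  have h := (hF (x, y)).hasFDerivAt.comp y (hasFDerivAt_prodMk_right (𝕜 := ℝ) x y)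
  exact DFunLike.congr_fun h.fderiv (Pi.single i 1)

lemma gradVec_gradVec_fst {F : (Fin n → ℝ) × (Fin n → ℝ) → ℝ} (hF : ContDiff ℝ 2 F)
    (x y : Fin n → ℝ) (i j : Fin n) :
    gradVec (fun x' => gradVec (fun x'' => F (x'', y)) x' j) x i
      = fderiv ℝ (fun q => fderiv ℝ F q (Pi.single j 1, 0)) (x, y) (Pi.single i 1, 0) := by
  simp_rw [gradVec_fst (hF.differentiable (by norm_num))]
  refine gradVec_fst (F := fun q => fderiv ℝ F q (Pi.single j 1, 0)) ?_ x y i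
  exact ((hF.fderiv_right (m := 1) (by norm_num)).clm_apply contDiff_const).differentiable
    (by norm_num)

lemma gradVec_gradVec_snd {F : (Fin n → ℝ) × (Fin n → ℝ) → ℝ} (hF : ContDiff ℝ 2 F)
    (x y : Fin n → ℝ) (i j : Fin n) :
    gradVec (fun y' => gradVec (fun y'' => F (x, y'')) y' j) y i
      = fderiv ℝ (fun q => fderiv ℝ F q (0, Pi.single j 1)) (x, y) (0, Pi.single i 1) := by
  simp_rw [gradVec_snd (hF.differentiable (by norm_num))]
  refine gradVec_snd (F := fun q => fderiv ℝ F q (0, Pi.single j 1)) ?_ x y i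
  exact ((hF.fderiv_right (m := 1) (by norm_num)).clm_apply contDiff_const).differentiable
    (by norm_num)

lemma contDiff_jointDensity {τ₁ τ₂ : ℝ} {U : (Fin n → ℝ) → ℝ} (hU : ContDiff ℝ 1 U) :
    ContDiff ℝ 1 (Function.uncurry (jointDensity τ₁ τ₂ U)) := by
  unfold Function.uncurry jointDensity
  fun_prop

lemma fderiv_jointDensity_apply {τ₁ τ₂ : ℝ} {U : (Fin n → ℝ) → ℝ} (hU : ContDiff ℝ 1 U)
    (x y : Fin n → ℝ) (v w : Fin n → ℝ) :
    fderiv ℝ (Function.uncurry (jointDensity τ₁ τ₂ U)) (x, y) (v, w)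
      = -(fderiv ℝ U x v / τ₁ + fderiv ℝ U y w / τ₂) * jointDensity τ₁ τ₂ U x y := by
  have hd := hU.differentiable (by norm_num)
  have h1 : HasFDerivAt (fun p : (Fin n → ℝ) × (Fin n → ℝ) => U p.1)
      ((fderiv ℝ U x).comp (.fst ℝ _ _)) (x, y) :=
    HasFDerivAt.comp (x, y) (hd x).hasFDerivAt hasFDerivAt_fst
  have h2 : HasFDerivAt (fun p : (Fin n → ℝ) × (Fin n → ℝ) => U p.2)
      ((fderiv ℝ U y).comp (.snd ℝ _ _)) (x, y) :=
    HasFDerivAt.comp (x, y) (hd y).hasFDerivAt hasFDerivAt_snd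
  have h : HasFDerivAt (Function.uncurry (jointDensity τ₁ τ₂ U)) _ (x, y) :=
    ((h1.neg.mul_const τ₁⁻¹).sub (h2.mul_const τ₂⁻¹)).exp
  rw [h.fderiv]
  simp [jointDensity, div_eq_mul_inv]
  ring

lemma swapS_mul_jointDensity (τ₁ τ₂ : ℝ) (U : (Fin n → ℝ) → ℝ) (x y : Fin n → ℝ) :
    swapS τ₁ τ₂ U x y * jointDensity τ₁ τ₂ U x y
      = min (jointDensity τ₁ τ₂ U x y) (jointDensity τ₁ τ₂ U y x) := by
  have h : 0 ≤ jointDensity τ₁ τ₂ U x y := (Real.exp_pos _).le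
  rw [swapS, min_mul_of_nonneg _ _ h, one_mul]
  congr 1
  rw [jointDensity, jointDensity, ← Real.exp_add]
  congr 1
  ring

/-- The drift and diffusion terms in one set of coordinates combine into divergence form. -/
lemma divForm_eq_of_fderiv_eq {Z : Type*} [NormedAddCommGroup Z] [NormedSpace ℝ Z]
    {W F : Z → ℝ} (hW : ContDiff ℝ 1 W) (hF : ContDiff ℝ 2 F)
    {L : Matrix (Fin n) (Fin n) ℝ} (hL : L.IsSymm) (v : Fin n → Z) (p : Z) {τ : ℝ} (hτ : τ ≠ 0)
    (u : Fin n → ℝ) (hu : ∀ i, fderiv ℝ W p (v i) = -(u i / τ) * W p) :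
    τ * divForm L v W F p
      = (-((L.mulVec u) ⬝ᵥ fun i => fderiv ℝ F p (v i))
        + τ * ∑ i, ∑ j, L i j * fderiv ℝ (fun q => fderiv ℝ F q (v j)) p (v i)) * W p := by
  have hprod (i j : Fin n) : fderiv ℝ (fun q => fderiv ℝ F q (v j) * W q) p (v i)
      = fderiv ℝ (fun q => fderiv ℝ F q (v j)) p (v i) * W p
        - fderiv ℝ F p (v j) * (u i / τ) * W p := by
    have hd : DifferentiableAt ℝ (fun q => fderiv ℝ F q (v j)) p :=
      ((hF.fderiv_right (m := 1) (by norm_num)).clm_apply contDiff_const).differentiable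
        (by norm_num) p
    rw [fderiv_fun_mul hd (hW.differentiable (by norm_num) p)]
    simp [hu]
    ring
  have hdot : (L.mulVec u) ⬝ᵥ (fun i => fderiv ℝ F p (v i))
      = ∑ i, ∑ j, L i j * (u i * fderiv ℝ F p (v j)) := by
    simp only [dotProduct, mulVec, Finset.sum_mul]
    rw [Finset.sum_comm]
    refine Finset.sum_congr rfl fun i _ => Finset.sum_congr rfl fun j _ => ?_
    rw [← hL.apply i j]
    ring
  rw [hdot]
  simp only [divForm, hprod, add_mul, neg_mul, Finset.mul_sum, Finset.sum_mul,
    ← Finset.sum_neg_distrib, ← Finset.sum_add_distrib]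
  refine Finset.sum_congr rfl fun i _ => Finset.sum_congr rfl fun j _ => ?_
  field_simp
  ring

lemma repGen_mul_jointDensity {τ₁ τ₂ : ℝ} (hτ₁ : τ₁ ≠ 0) (hτ₂ : τ₂ ≠ 0)
    {L : Matrix (Fin n) (Fin n) ℝ} (hL : L.IsSymm) (c : ℝ)
    {U : (Fin n → ℝ) → ℝ} (hU : ContDiff ℝ 1 U) {f : (Fin n → ℝ) → (Fin n → ℝ) → ℝ}
    (hf : ContDiff ℝ 2 (Function.uncurry f)) (p : (Fin n → ℝ) × (Fin n → ℝ)) :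
    repGen L τ₁ τ₂ c U f p.1 p.2 * jointDensity τ₁ τ₂ U p.1 p.2
      = τ₁ * divForm L (fun i => (Pi.single i 1, 0)) (Function.uncurry (jointDensity τ₁ τ₂ U))
          (Function.uncurry f) p
        + τ₂ * divForm L (fun i => (0, Pi.single i 1)) (Function.uncurry (jointDensity τ₁ τ₂ U))
          (Function.uncurry f) p
        + c * (min (Function.uncurry (jointDensity τ₁ τ₂ U) p)
            (Function.uncurry (jointDensity τ₁ τ₂ U) p.swap)
          * (Function.uncurry f p.swap - Function.uncurry f p)) := by
  obtain ⟨x, y⟩ := p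
  have hW := contDiff_jointDensity (τ₁ := τ₁) (τ₂ := τ₂) hU
  have hd := hf.differentiable (by norm_num)
  rw [divForm_eq_of_fderiv_eq hW hf hL _ (x, y) hτ₁ (gradVec U x)
      (fun i => by simp [fderiv_jointDensity_apply hU, gradVec]),
    divForm_eq_of_fderiv_eq hW hf hL _ (x, y) hτ₂ (gradVec U y)
      (fun i => by simp [fderiv_jointDensity_apply hU, gradVec])]
  simp only [Prod.swap_prod_mk, Function.uncurry_apply_pair, ← swapS_mul_jointDensity]
  have e1 : gradVec (fun x' => f x' y) x
      = fun i => fderiv ℝ (Function.uncurry f) (x, y) (Pi.single i 1, 0) :=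
    funext fun i => gradVec_fst hd x y i
  have e2 : gradVec (f x) y
      = fun i => fderiv ℝ (Function.uncurry f) (x, y) (0, Pi.single i 1) :=
    funext fun i => gradVec_snd hd x y i
  have e3 := gradVec_gradVec_fst hf x y
  have e4 := gradVec_gradVec_snd hf x y
  simp only [Function.uncurry_apply_pair] at e3 e4
  simp only [repGen, e1, e2, e3, e4]
  ring

end Partial

/-- Detailed balance identity for the full replica exchange generator with respect to the
joint density `π`. -/
theorem detailed_balance_repGen (n : ℕ) (hn : 1 ≤ n)
    (τ₁ τ₂ : ℝ) (hτ₁ : 0 < τ₁) (hτ₁₂ : τ₁ < τ₂)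
    (L : Matrix (Fin n) (Fin n) ℝ) (hL : L.IsSymm)
    (c : ℝ) (hc : 0 ≤ c)
    (U : (Fin n → ℝ) → ℝ) (hU : ContDiff ℝ 1 U)
    (f g : (Fin n → ℝ) → (Fin n → ℝ) → ℝ)
    (hf : ContDiff ℝ 2 (Function.uncurry f)) (hfc : HasCompactSupport (Function.uncurry f))
    (hg : ContDiff ℝ 2 (Function.uncurry g)) (hgc : HasCompactSupport (Function.uncurry g)) :
    ∫ x : Fin n → ℝ, ∫ y : Fin n → ℝ,
        g x y * repGen L τ₁ τ₂ c U f x y * jointDensity τ₁ τ₂ U x y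
      = ∫ x : Fin n → ℝ, ∫ y : Fin n → ℝ,
          f x y * repGen L τ₁ τ₂ c U g x y * jointDensity τ₁ τ₂ U x y := by
  have hτ₂ : τ₂ ≠ 0 := (hτ₁.trans hτ₁₂).ne'
  set W := Function.uncurry (jointDensity τ₁ τ₂ U) with hWdef
  have hW : ContDiff ℝ 1 W := contDiff_jointDensity hU
  have : (volume : Measure ((Fin n → ℝ) × (Fin n → ℝ))).IsAddHaarMeasure :=
    Measure.prod.instIsAddHaarMeasure volume volume
  have hK : Continuous fun p => min (W p) (W p.swap) :=
    hW.continuous.min (hW.continuous.comp continuous_swap)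
  have hKs (p) : min (W p.swap) (W p.swap.swap) = min (W p) (W p.swap) := by
    rw [Prod.swap_swap, min_comm]
  have key (f g : (Fin n → ℝ) → (Fin n → ℝ) → ℝ) (hf : ContDiff ℝ 2 (Function.uncurry f))
      (hg : ContDiff ℝ 2 (Function.uncurry g)) (hgc : HasCompactSupport (Function.uncurry g)) :
      ∫ x : Fin n → ℝ, ∫ y : Fin n → ℝ,
          g x y * repGen L τ₁ τ₂ c U f x y * jointDensity τ₁ τ₂ U x y
        = τ₁ * (∫ p, Function.uncurry g p
            * divForm L (fun i => (Pi.single i 1, 0)) W (Function.uncurry f) p)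
          + τ₂ * (∫ p, Function.uncurry g p
            * divForm L (fun i => (0, Pi.single i 1)) W (Function.uncurry f) p)
          + c * ∫ p, Function.uncurry g p * (min (W p) (W p.swap)
            * (Function.uncurry f p.swap - Function.uncurry f p)) := by
    have hint {φ : (Fin n → ℝ) × (Fin n → ℝ) → ℝ} (hφ : Continuous φ) :
        Integrable fun p => Function.uncurry g p * φ p :=
      (hg.continuous.mul hφ).integrable_of_hasCompactSupport hgc.mul_right
    have i1 := (hint (continuous_divForm hW hf L fun i => (Pi.single i 1, 0))).const_mul τ₁
    have i2 := (hint (continuous_divForm hW hf L fun i => (0, Pi.single i 1))).const_mul τ₂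
    have i3 := (hint (hK.fun_mul
      ((hf.continuous.comp' continuous_swap).fun_sub hf.continuous))).const_mul c
    have heq : (fun p : (Fin n → ℝ) × (Fin n → ℝ) =>
        g p.1 p.2 * repGen L τ₁ τ₂ c U f p.1 p.2 * jointDensity τ₁ τ₂ U p.1 p.2)
        = fun p => τ₁ * (Function.uncurry g p
            * divForm L (fun i => (Pi.single i 1, 0)) W (Function.uncurry f) p)
          + τ₂ * (Function.uncurry g p
            * divForm L (fun i => (0, Pi.single i 1)) W (Function.uncurry f) p)
          + c * (Function.uncurry g p * (min (W p) (W p.swap)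
            * (Function.uncurry f p.swap - Function.uncurry f p))) := by
      funext p
      rw [mul_assoc, repGen_mul_jointDensity hτ₁.ne' hτ₂ hL c hU hf, ← hWdef]
      simp only [Function.uncurry]
      ring
    have i12 := i1.fun_add i2
    rw [← integral_const_mul, ← integral_const_mul, ← integral_const_mul,
      ← integral_add i1 i2, ← integral_add i12 i3, ← heq]
    have i0 := i12.fun_add i3
    rw [← heq] at i0
    exact (integral_prod (μ := volume) (ν := volume) _ i0).symm
  rw [key f g hf hg hgc, key g f hg hf hfc,
    integral_mul_divForm_comm _ hW hf hfc hg hgc hL,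
    integral_mul_divForm_comm _ hW hf hfc hg hgc hL,
    integral_mul_swap_sub_comm hK hKs hf.continuous hfc hg.continuous hgc]
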